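/- For every integer n ≥ 2 and every ε > 0 there exists q_0 such that for every prime power q ≥ q_0, the number of general position sets in 𝔽_q^n is at most 2^{q + q^{2/3+ε}}. -/

import Mathlib

open scoped Classical in
/-- Cauchy–Schwarz: a map into a set of size `k` has many colliding pairs. -/
theorem card_sq_le_card_mul_card_collisions {ι κ : Type*} [Fintype ι] [Fintype κ] (f : ι → κ) :
    Fintype.card ι ^ 2 ≤ Fintype.card κ *
      (Finset.univ.filter fun z : ι × ι => f z.1 = f z.2).card := by
  have h1 : Fintype.card ι = ∑ c : κ, (Finset.univ.filter fun i => f i = c).card := by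
    rw [← Finset.card_univ]
    exact Finset.card_eq_sum_card_fiberwise (fun x _ => Finset.mem_coe.2 (Finset.mem_univ (f x)))
  have h2 : (Finset.univ.filter fun z : ι × ι => f z.1 = f z.2).card
      = ∑ c : κ, (Finset.univ.filter fun i => f i = c).card ^ 2 := by
    rw [Finset.card_eq_sum_card_fiberwise (f := fun z : ι × ι => f z.1) (t := Finset.univ)
      (fun x _ => Finset.mem_coe.2 (Finset.mem_univ _))]
    refine Finset.sum_congr rfl fun c _ => ?_
    rw [sq, ← Finset.card_product]
    congr 1
    ext z
    simp only [Finset.mem_filter, Finset.mem_univ, true_and, Finset.mem_product]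
    constructor
    · rintro ⟨h, h'⟩
      exact ⟨h', h ▸ h'⟩
    · rintro ⟨h, h'⟩
      exact ⟨h.trans h'.symm, h⟩
  rw [h1, h2]
  exact sq_sum_le_card_mul_sum_sq

/-- The Kleitman–Winston bound on the number of independent sets of a relation in which every
large set contains a vertex of large out-degree. -/
theorem card_independent_le {α : Type*} [DecidableEq α] (r : α → α → Prop) [DecidableRel r]
    (R : ℕ) (β : ℝ) (hβ : β ≤ 1) (A : Finset α)
    (h : ∀ B ⊆ A, R < B.card → ∃ x ∈ B, β * B.card ≤ (B.filter fun y => y ≠ x ∧ r x y).card)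
    (m : ℕ) (hm : (1 - β) ^ m * A.card ≤ R) :
    (A.powerset.filter fun I => ∀ x ∈ I, ∀ y ∈ I, y ≠ x → ¬ r x y).card
      ≤ 2 ^ R * (A.card + 1) ^ m := by
  induction hN : A.card using Nat.strong_induction_on generalizing A m with
  | _ N ih =>
  subst hN
  have htriv : A.card ≤ R → (A.powerset.filter fun I => ∀ x ∈ I, ∀ y ∈ I, y ≠ x → ¬ r x y).card
      ≤ 2 ^ R * (A.card + 1) ^ m := fun hR =>
    calc _ ≤ A.powerset.card := Finset.card_filter_le _ _
      _ = 2 ^ A.card := Finset.card_powerset A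
      _ ≤ 2 ^ R := Nat.pow_le_pow_right (by norm_num) hR
      _ ≤ _ := Nat.le_mul_of_pos_right _ (by positivity)
  rcases le_or_gt A.card R with hR | hR
  · exact htriv hR
  obtain ⟨x, hxA, hx⟩ := h A subset_rfl hR
  cases m with
  | zero => exact htriv (by simpa using hm)
  | succ m =>
  set B := A.erase x with hB
  set C := B.filter fun y => ¬ r x y with hC
  have hBA : B ⊆ A := Finset.erase_subset _ _
  have hCB : C ⊆ B := Finset.filter_subset _ _
  have hBcard : B.card < A.card := Finset.card_erase_lt_of_mem hxA
  have hCle : C.card ≤ B.card := Finset.card_le_card hCB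
  have hCcard : (C.card : ℝ) ≤ (1 - β) * A.card := by
    have h1 : (A.filter fun y => y ≠ x ∧ r x y) = B.filter fun y => r x y := by
      ext y
      simp only [hB, Finset.mem_filter, Finset.mem_erase]
      tauto
    have h2 : (B.filter fun y => r x y).card + C.card = B.card :=
      Finset.card_filter_add_card_filter_not _
    rw [h1] at hx
    have h3 : ((B.filter fun y => r x y).card : ℝ) + C.card ≤ A.card := by
      exact_mod_cast h2.le.trans hBcard.le
    linarith
  have hβ' : 0 ≤ 1 - β := by linarith
  have ihB := ih B.card hBcard B (fun D hD => h D (hD.trans hBA)) (m + 1)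
    (le_trans (by gcongr) hm) rfl
  have ihC := ih C.card (by omega) C (fun D hD => h D (hD.trans (hCB.trans hBA))) m
    (le_trans (by rw [pow_succ, mul_assoc]; gcongr) hm) rfl
  have hsub : (A.powerset.filter fun I => ∀ x ∈ I, ∀ y ∈ I, y ≠ x → ¬ r x y) ⊆
      (B.powerset.filter fun I => ∀ x ∈ I, ∀ y ∈ I, y ≠ x → ¬ r x y) ∪
      (C.powerset.filter fun I => ∀ x ∈ I, ∀ y ∈ I, y ≠ x → ¬ r x y).image (insert x) := by
    intro I hI
    obtain ⟨hIA, hI⟩ := Finset.mem_filter.1 hI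
    rw [Finset.mem_powerset] at hIA
    rw [Finset.mem_union]
    by_cases hxI : x ∈ I
    · right
      refine Finset.mem_image.2 ⟨I.erase x, ?_, Finset.insert_erase hxI⟩
      refine Finset.mem_filter.2 ⟨Finset.mem_powerset.2 fun y hy => ?_, fun y hy z hz =>
        hI y (Finset.mem_of_mem_erase hy) z (Finset.mem_of_mem_erase hz)⟩
      obtain ⟨hyx, hy⟩ := Finset.mem_erase.1 hy
      exact Finset.mem_filter.2 ⟨Finset.mem_erase.2 ⟨hyx, hIA hy⟩, hI x hxI y hy hyx⟩
    · left
      exact Finset.mem_filter.2 ⟨Finset.mem_powerset.2 fun y hy =>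
        Finset.mem_erase.2 ⟨fun h => hxI (h ▸ hy), hIA hy⟩, hI⟩
  calc _ ≤ _ := Finset.card_le_card hsub
    _ ≤ _ := Finset.card_union_le _ _
    _ ≤ 2 ^ R * (B.card + 1) ^ (m + 1) + 2 ^ R * (C.card + 1) ^ m :=
      add_le_add ihB (Finset.card_image_le.trans ihC)
    _ ≤ 2 ^ R * A.card ^ (m + 1) + 2 ^ R * (A.card + 1) ^ m := by
      have hCA : C.card ≤ A.card := hCle.trans hBcard.le
      gcongr
      exact hBcard
    _ ≤ 2 ^ R * ((A.card + 1) ^ m * A.card) + 2 ^ R * (A.card + 1) ^ m := by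
      rw [pow_succ]
      gcongr
      exact Nat.le_succ _
    _ = 2 ^ R * (A.card + 1) ^ (m + 1) := by ring

section Collisions

variable (F : Type*) {E : Type*} [Field F] [AddCommGroup E] [Module F E]

/-- No point of `A` outside `Q` lies in the span of a set `Q ⊆ T` of at most `n` points. -/
def AvoidsSpans (n : ℕ) (T A : Finset E) : Prop :=
  ∀ Q ⊆ T, Q.card ≤ n → ∀ a ∈ A, a ∉ Q → a ∉ Submodule.span F (Q : Set E)

/-- `x` and `y` have the same image under the projection from fewer than `n` points of `T`. -/
def CollideOver (n : ℕ) (T : Finset E) (x y : E) : Prop :=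
  ∃ Q ⊆ T, Q.card < n ∧ y ∈ Submodule.span F (insert x (Q : Set E))

open scoped Classical in
/-- The ordered pairs of distinct points of `A` with the same image under projection from `P`. -/
noncomputable def collisions (A P : Finset E) : Finset (E × E) :=
  (A ×ˢ A).filter fun z => z.2 ≠ z.1 ∧ z.2 ∈ Submodule.span F (insert z.1 (P : Set E))

variable {F}

theorem mem_collisions {A P : Finset E} {z : E × E} : z ∈ collisions F A P ↔
    (z.1 ∈ A ∧ z.2 ∈ A) ∧ z.2 ≠ z.1 ∧ z.2 ∈ Submodule.span F (insert z.1 (P : Set E)) := by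
  simp [collisions]

theorem AvoidsSpans.linearIndepOn {n : ℕ} {P : Finset E} (hP : AvoidsSpans F n P P)
    (hcard : P.card ≤ n + 1) : LinearIndepOn F id (P : Set E) := by
  classical
  unfold LinearIndepOn
  rw [linearIndependent_iff_notMem_span]
  rintro ⟨p, hp⟩ h
  have hp' : p ∈ P := hp
  refine hP (P.erase p) (Finset.erase_subset _ _) ?_ p hp' (Finset.notMem_erase _ _) ?_
  · rw [Finset.card_erase_of_mem hp']
    omega
  · refine Submodule.span_mono ?_ h
    rintro _ ⟨⟨x, hx⟩, hxp, rfl⟩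
    simp only [Set.mem_sdiff, Set.mem_univ, true_and, Set.mem_singleton_iff, Subtype.mk.injEq] at hxp
    simpa [hxp] using hx

theorem AvoidsSpans.mono {n : ℕ} {T T' A A' : Finset E} (h : AvoidsSpans F n T A) (hT : T' ⊆ T)
    (hA : A' ⊆ A) : AvoidsSpans F n T' A' :=
  fun Q hQ hc a ha => h Q (hQ.trans hT) hc a (hA ha)

theorem card_sq_le_collisions [Fintype F] [FiniteDimensional F E] {A P : Finset E}
    (hP : Module.finrank F (E ⧸ Submodule.span F (P : Set E)) = 2)
    (hA : ∀ x ∈ A, x ∉ Submodule.span F (P : Set E)) :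
    A.card ^ 2 ≤ (Fintype.card F + 1) * ((collisions F A P).card + A.card) := by
  classical
  set U := Submodule.span F (P : Set E) with hU
  have hne : ∀ x : A, U.mkQ x.1 ≠ 0 := fun x h =>
    hA x.1 x.2 ((Submodule.Quotient.mk_eq_zero U).1 h)
  have : Finite E := Module.finite_of_finite F
  have : Finite (E ⧸ U) := Module.finite_of_finite F
  have : Fintype (Projectivization F (E ⧸ U)) := Fintype.ofFinite _
  let f : A → Projectivization F (E ⧸ U) := fun x => Projectivization.mk F (U.mkQ x.1) (hne x)
  have h1 := card_sq_le_card_mul_card_collisions f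
  rw [← Nat.card_eq_fintype_card (α := Projectivization F (E ⧸ U)),
    Projectivization.card_of_finrank_two F _ hP, Nat.card_eq_fintype_card,
    Fintype.card_coe] at h1
  refine h1.trans (Nat.mul_le_mul_left _ ?_)
  have h2 : ((Finset.univ.filter fun z : A × A => f z.1 = f z.2).image
      fun z => ((z.1 : E), (z.2 : E))) ⊆ collisions F A P ∪ A.image fun x => (x, x) := by
    intro z hz
    obtain ⟨⟨x, y⟩, hxy, rfl⟩ := Finset.mem_image.1 hz
    have hxy : f x = f y := (Finset.mem_filter.1 hxy).2
    by_cases hne : (y : E) = x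
    · exact Finset.mem_union_right _ (Finset.mem_image.2 ⟨x, x.2, by rw [hne]⟩)
    · refine Finset.mem_union_left _ (mem_collisions.2 ⟨⟨x.2, y.2⟩, hne, ?_⟩)
      obtain ⟨a, ha⟩ := (Projectivization.mk_eq_mk_iff' F _ _ _ _).1 hxy.symm
      refine Submodule.mem_span_insert.2 ⟨a, y.1 - a • x.1, ?_, by abel⟩
      rw [← hU, ← Submodule.Quotient.mk_eq_zero U]
      simpa [sub_eq_zero] using ha.symm
  have h3 : Function.Injective fun z : A × A => ((z.1 : E), (z.2 : E)) := by
    rintro ⟨⟨a, _⟩, ⟨b, _⟩⟩ ⟨⟨c, _⟩, ⟨d, _⟩⟩ h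
    simpa using h
  rw [← Finset.card_image_of_injective _ h3]
  exact (Finset.card_le_card h2).trans
    ((Finset.card_union_le _ _).trans (Nat.add_le_add_left Finset.card_image_le _))

/-- A pair colliding over `P ∪ {p}` and `P ∪ {p'}` already collides over `P`. -/
theorem collision_of_insert_of_insert {n : ℕ} {T A P : Finset E} (hT : AvoidsSpans F n T T)
    (hA : ∀ Q ⊆ T, Q.card ≤ n → ∀ a ∈ A, a ∉ Submodule.span F (Q : Set E))
    (hPT : P ⊆ T) (hPn : P.card + 2 ≤ n) {p p' x y : E} (hp : p ∈ T) (hpP : p ∉ P)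
    (hp' : p' ∈ T) (hne : p ≠ p') (hx : x ∈ A)
    (h : y ∈ Submodule.span F (insert x (insert p (P : Set E))))
    (h' : y ∈ Submodule.span F (insert x (insert p' (P : Set E)))) :
    y ∈ Submodule.span F (insert x (P : Set E)) := by
  classical
  by_contra hy
  rw [Set.insert_comm] at h
  have h1 : p ∈ Submodule.span F (insert y (insert x (P : Set E))) :=
    mem_span_insert_exchange h hy
  have h2 : p ∈ Submodule.span F (insert x (insert p' (P : Set E))) := by
    refine Submodule.span_le.2 ?_ h1
    rintro z (rfl | rfl | hz)
    · exact h'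
    · exact Submodule.subset_span (Set.mem_insert _ _)
    · exact Submodule.subset_span (Set.mem_insert_of_mem _ (Set.mem_insert_of_mem _ hz))
  have hc : (insert p' P).card ≤ P.card + 1 := Finset.card_insert_le _ _
  have h3 : p ∉ Submodule.span F (insert p' (P : Set E)) := by
    rw [← Finset.coe_insert]
    exact hT (insert p' P) (Finset.insert_subset hp' hPT) (by omega) p hp
      (by simp [hne, hpP])
  have h4 := mem_span_insert_exchange h2 h3
  rw [← Finset.coe_insert, ← Finset.coe_insert] at h4
  refine hA (insert p (insert p' P))
    (Finset.insert_subset hp (Finset.insert_subset hp' hPT)) ?_ x hx h4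
  have := Finset.card_insert_le p (insert p' P)
  omega

open scoped Classical in
/-- Some projection from `j < n` points of `T` makes few pairs collide, compared with the number of
pairs colliding under at least one of these projections. -/
theorem exists_few_collisions {n : ℕ} {T A : Finset E} (hT : AvoidsSpans F n T T)
    (hA : ∀ Q ⊆ T, Q.card ≤ n → ∀ a ∈ A, a ∉ Submodule.span F (Q : Set E))
    (hinj : ∀ x ∈ A, ∀ y ∈ A, y ∈ Submodule.span F {x} → y = x) {δ : ℝ}
    (hδ : (((A ×ˢ A).filter fun z => z.2 ≠ z.1 ∧ CollideOver F n T z.1 z.2).card : ℝ)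
      ≤ ((T.card : ℝ) - n) * δ) (hδ0 : 0 ≤ δ) (hTn : n < T.card) (j : ℕ) (hj : j < n) :
    ∃ P ⊆ T, P.card = j ∧ ((collisions F A P).card : ℝ) ≤ j * δ := by
  induction j with
  | zero =>
    refine ⟨∅, Finset.empty_subset _, rfl, ?_⟩
    have : collisions F A ∅ = ∅ := by
      refine Finset.eq_empty_of_forall_notMem fun z hz => ?_
      obtain ⟨⟨h1, h2⟩, h3, h4⟩ := mem_collisions.1 hz
      exact h3 (hinj _ h1 _ h2 (by simpa using h4))
    simp [this]
  | succ j ih =>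
    obtain ⟨P, hPT, hPj, hP⟩ := ih (by omega)
    have hcard : (T \ P).card = T.card - j := by rw [Finset.card_sdiff_of_subset hPT, hPj]
    have hne : (T \ P).Nonempty := Finset.card_pos.1 (by omega)
    have hdisj : ((T \ P : Finset E) : Set E).PairwiseDisjoint
        fun p => collisions F A (insert p P) \ collisions F A P := by
      intro p hp p' hp' hpp'
      rw [Function.onFun, Finset.disjoint_left]
      intro z hz hz'
      rw [Finset.mem_coe, Finset.mem_sdiff] at hp hp'
      rw [Finset.mem_sdiff, mem_collisions] at hz hz'
      simp only [Finset.coe_insert] at hz hz'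
      refine hz.2 (mem_collisions.2 ⟨hz.1.1, hz.1.2.1, ?_⟩)
      exact collision_of_insert_of_insert hT hA hPT (by omega) hp.1 hp.2 hp'.1 hpp' hz.1.1.1
        hz.1.2.2 hz'.1.2.2
    have hsum : ∑ p ∈ T \ P, ((collisions F A (insert p P) \ collisions F A P).card : ℝ)
        ≤ ∑ _p ∈ T \ P, δ := by
      rw [Finset.sum_const, nsmul_eq_mul, hcard, Nat.cast_sub (by omega), ← Nat.cast_sum,
        ← Finset.card_biUnion hdisj]
      refine le_trans ?_ (hδ.trans ?_)
      · rw [Nat.cast_le]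
        refine Finset.card_le_card fun z hz => ?_
        obtain ⟨p, hp, hz⟩ := Finset.mem_biUnion.1 hz
        obtain ⟨h1, h2, h3⟩ := mem_collisions.1 (Finset.mem_sdiff.1 hz).1
        refine Finset.mem_filter.2 ⟨Finset.mem_product.2 h1, h2, insert p P,
          Finset.insert_subset (Finset.mem_sdiff.1 hp).1 hPT, ?_, h3⟩
        have := Finset.card_insert_le p P
        omega
      · have : (j : ℝ) ≤ n := by exact_mod_cast (by omega : j ≤ n)
        gcongr
    obtain ⟨p, hp, hpδ⟩ := Finset.exists_le_of_sum_le hne hsum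
    obtain ⟨hpT, hpP⟩ := Finset.mem_sdiff.1 hp
    refine ⟨insert p P, Finset.insert_subset hpT hPT, by
      rw [Finset.card_insert_of_notMem hpP, hPj], ?_⟩
    have h1 : (collisions F A (insert p P)).card ≤
        (collisions F A (insert p P) \ collisions F A P).card + (collisions F A P).card := by
      rw [add_comm]
      exact Finset.card_le_card_sdiff_add_card.trans (add_comm _ _).le
    have h2 : ((collisions F A (insert p P)).card : ℝ) ≤
        (collisions F A (insert p P) \ collisions F A P).card + (collisions F A P).card := by
      exact_mod_cast h1
    push_cast
    linarith

open scoped Classical in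
/-- Supersaturation: if `A` has more than `q + 1` points, then some point of `A` collides with many
others. -/
theorem exists_large_degree [Fintype F] [FiniteDimensional F E] {n : ℕ} (hn : 1 ≤ n)
    (hE : Module.finrank F E = n + 1) {T A : Finset E} (hT : AvoidsSpans F n T T)
    (hA : ∀ Q ⊆ T, Q.card ≤ n → ∀ a ∈ A, a ∉ Submodule.span F (Q : Set E))
    (hinj : ∀ x ∈ A, ∀ y ∈ A, y ∈ Submodule.span F {x} → y = x) (hTn : n < T.card)
    (hAne : A.Nonempty) :
    ∃ x ∈ A, ((T.card : ℝ) - n) * (A.card - (Fintype.card F + 1)) ≤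
      n * (Fintype.card F + 1) * (A.filter fun y => y ≠ x ∧ CollideOver F n T x y).card := by
  set N := ((A ×ˢ A).filter fun z => z.2 ≠ z.1 ∧ CollideOver F n T z.1 z.2).card with hN
  set q : ℝ := (Fintype.card F : ℝ) with hq
  have hTn' : (0 : ℝ) < (T.card : ℝ) - n := by
    rw [sub_pos]
    exact_mod_cast hTn
  have hnR : (1 : ℝ) ≤ n := by exact_mod_cast hn
  obtain ⟨P, hPT, hPn, hP⟩ := exists_few_collisions hT hA hinj (δ := N / ((T.card : ℝ) - n))
    (by rw [mul_div_cancel₀ _ hTn'.ne']) (by positivity) hTn (n - 1) (by omega)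
  have hrank : Module.finrank F (E ⧸ Submodule.span F (P : Set E)) = 2 := by
    have h1 := Submodule.finrank_quotient_add_finrank (Submodule.span F (P : Set E))
    rw [finrank_span_finset_eq_card ((hT.mono hPT hPT).linearIndepOn (by omega)), hE, hPn] at h1
    omega
  have h2 : (A.card : ℝ) ^ 2 ≤ (q + 1) * ((collisions F A P).card + A.card) := by
    rw [hq]
    exact_mod_cast card_sq_le_collisions hrank (hA P hPT (by omega))
  have hq0 : 0 ≤ q := Nat.cast_nonneg _
  have hcol : ((T.card : ℝ) - n) * (collisions F A P).card ≤ n * N := by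
    have h3 : (((n - 1 : ℕ) : ℝ)) ≤ n := by exact_mod_cast Nat.sub_le _ _
    calc _ ≤ ((T.card : ℝ) - n) * (n * (N / ((T.card : ℝ) - n))) := by
            gcongr
            exact hP.trans (by gcongr)
      _ = n * N := by field_simp
  have hNsum : N = ∑ x ∈ A, (A.filter fun y => y ≠ x ∧ CollideOver F n T x y).card := by
    rw [hN, Finset.card_filter, Finset.sum_product]
    simp only [Finset.card_filter]
  have hsum : ∑ _x ∈ A, ((T.card : ℝ) - n) * (A.card - (q + 1)) ≤
      ∑ x ∈ A, n * (q + 1) * ((A.filter fun y => y ≠ x ∧ CollideOver F n T x y).card : ℝ) := by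
    rw [← Finset.mul_sum A _ ((n : ℝ) * (q + 1)), ← Nat.cast_sum, ← hNsum, Finset.sum_const,
      nsmul_eq_mul]
    calc _ = ((T.card : ℝ) - n) * ((A.card : ℝ) ^ 2 - (q + 1) * A.card) := by ring
      _ ≤ ((T.card : ℝ) - n) * ((q + 1) * (collisions F A P).card) := by
        gcongr
        linarith
      _ = (q + 1) * (((T.card : ℝ) - n) * (collisions F A P).card) := by ring
      _ ≤ (q + 1) * (n * N) := by gcongr
      _ = _ := by ring
  exact Finset.exists_le_of_sum_le hAne hsum

open scoped Classical in
/-- Counting sets in general position by a fingerprint `T` of size `t` together with an independent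
set in the collision graph of `T`. -/
theorem card_avoidsSpans_le [Fintype F] [FiniteDimensional F E] {n t m R : ℕ} (hn : 1 ≤ n)
    (hE : Module.finrank F E = n + 1) {X : Finset E}
    (hinj : ∀ x ∈ X, ∀ y ∈ X, y ∈ Submodule.span F {x} → y = x) (hX : 2 ≤ X.card) (ht : n < t)
    {β : ℝ} (hβ1 : β ≤ 1)
    (hβ : ∀ a : ℕ, R < a → β * a * (n * (Fintype.card F + 1)) ≤
      ((t : ℝ) - n) * (a - (Fintype.card F + 1)))
    (hm : (1 - β) ^ m * X.card ≤ R) :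
    (X.powerset.filter fun S => t ≤ S.card → AvoidsSpans F n S S).card ≤
      2 * (X.card + 1) ^ (t + m) * 2 ^ R := by
  let 𝒯 := (X.powersetCard t).filter fun T => AvoidsSpans F n T T
  let A : Finset E → Finset E := fun T => X.filter fun x =>
    ∀ Q ⊆ T, Q.card ≤ n → x ∉ Submodule.span F (Q : Set E)
  let ℐ : Finset E → Finset (Finset E) := fun T =>
    (A T).powerset.filter fun I => ∀ x ∈ I, ∀ y ∈ I, y ≠ x → ¬ CollideOver F n T x y
  have hsub : (X.powerset.filter fun S => t ≤ S.card → AvoidsSpans F n S S) ⊆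
      ((Finset.range t).biUnion fun i => X.powersetCard i) ∪
        𝒯.biUnion fun T => (ℐ T).image fun I => T ∪ I := by
    intro S hS
    obtain ⟨hSX, hS⟩ := Finset.mem_filter.1 hS
    rw [Finset.mem_powerset] at hSX
    rw [Finset.mem_union]
    rcases lt_or_ge S.card t with hSt | hSt
    · exact Or.inl (Finset.mem_biUnion.2 ⟨S.card, Finset.mem_range.2 hSt,
        Finset.mem_powersetCard.2 ⟨hSX, rfl⟩⟩)
    replace hS := hS hSt
    obtain ⟨T, hTS, hTt⟩ := Finset.exists_subset_card_eq hSt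
    refine Or.inr (Finset.mem_biUnion.2 ⟨T, Finset.mem_filter.2
      ⟨Finset.mem_powersetCard.2 ⟨hTS.trans hSX, hTt⟩, hS.mono hTS hTS⟩, Finset.mem_image.2
      ⟨S \ T, Finset.mem_filter.2 ⟨Finset.mem_powerset.2 fun x hx => ?_, ?_⟩,
        Finset.union_sdiff_of_subset hTS⟩⟩)
    · obtain ⟨hxS, hxT⟩ := Finset.mem_sdiff.1 hx
      exact Finset.mem_filter.2 ⟨hSX hxS, fun Q hQ hQn =>
        hS Q (hQ.trans hTS) hQn x hxS fun hxQ => hxT (hQ hxQ)⟩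
    · rintro x hx y hy hyx ⟨Q, hQT, hQn, hyQ⟩
      obtain ⟨hxS, hxT⟩ := Finset.mem_sdiff.1 hx
      obtain ⟨hyS, hyT⟩ := Finset.mem_sdiff.1 hy
      refine hS (insert x Q) (Finset.insert_subset hxS (hQT.trans hTS)) ?_ y hyS ?_ ?_
      · have := Finset.card_insert_le x Q
        omega
      · rw [Finset.mem_insert, not_or]
        exact ⟨hyx, fun h => hyT (hQT h)⟩
      · rwa [Finset.coe_insert]
  have hsmall : ((Finset.range t).biUnion fun i => X.powersetCard i).card ≤ X.card ^ t :=
    calc _ ≤ ∑ i ∈ Finset.range t, (X.powersetCard i).card := Finset.card_biUnion_le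
      _ ≤ ∑ i ∈ Finset.range t, X.card ^ i := Finset.sum_le_sum fun i _ => by
        rw [Finset.card_powersetCard]
        exact Nat.choose_le_pow _ _
      _ ≤ X.card ^ t := (Nat.geomSum_lt hX fun k hk => Finset.mem_range.1 hk).le
  have hℐ : ∀ T ∈ 𝒯, (ℐ T).card ≤ 2 ^ R * (X.card + 1) ^ m := by
    intro T hT
    obtain ⟨hTX, hT⟩ := Finset.mem_filter.1 hT
    have hTt : T.card = t := (Finset.mem_powersetCard.1 hTX).2
    have hAX : (A T).card ≤ X.card := Finset.card_filter_le _ _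
    refine (card_independent_le (CollideOver F n T) R β hβ1 (A T) ?_ m ?_).trans (by gcongr)
    · intro B hB hRB
      obtain ⟨x, hx, hdeg⟩ := exists_large_degree hn hE hT (A := B)
        (fun Q hQ hQn a ha => (Finset.mem_filter.1 (hB ha)).2 Q hQ hQn)
        (fun x hx y hy => hinj x (Finset.mem_filter.1 (hB hx)).1 y (Finset.mem_filter.1 (hB hy)).1)
        (by omega) (Finset.card_pos.1 (by omega))
      refine ⟨x, hx, ?_⟩
      have hpos : (0 : ℝ) < n * (Fintype.card F + 1) := by
        have : (0 : ℝ) < n := by exact_mod_cast hn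
        positivity
      rw [hTt] at hdeg
      have := (hβ _ hRB).trans hdeg
      rw [mul_comm] at this
      exact le_of_mul_le_mul_left this hpos
    · refine le_trans ?_ hm
      have : 0 ≤ 1 - β := by linarith
      gcongr
  have h𝒯 : 𝒯.card ≤ X.card ^ t := by
    refine (Finset.card_filter_le _ _).trans ?_
    rw [Finset.card_powersetCard]
    exact Nat.choose_le_pow _ _
  have hX1 : X.card ^ t ≤ (X.card + 1) ^ t := Nat.pow_le_pow_left (Nat.le_succ _) _
  calc _ ≤ _ := Finset.card_le_card hsub
    _ ≤ _ := Finset.card_union_le _ _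
    _ ≤ X.card ^ t + 𝒯.card * (2 ^ R * (X.card + 1) ^ m) :=
      Nat.add_le_add hsmall (Finset.card_biUnion_le_card_mul _ _ _ fun T hT =>
        Finset.card_image_le.trans (hℐ T hT))
    _ ≤ (X.card + 1) ^ t * (2 ^ R * (X.card + 1) ^ m) +
        (X.card + 1) ^ t * (2 ^ R * (X.card + 1) ^ m) := by
      refine Nat.add_le_add (hX1.trans (Nat.le_mul_of_pos_right _ (by positivity))) ?_
      gcongr
      exact h𝒯.trans hX1
    _ = 2 * (X.card + 1) ^ (t + m) * 2 ^ R := by ring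

end Collisions

section Homogenization

variable {F : Type} [Field F] {n : ℕ}

/-- In homogeneous coordinates, a set of more than `n` points meeting every affine hyperplane in at
most `n` points avoids the spans of its subsets of size at most `n`. -/
theorem avoidsSpans_homogenize [Finite F] [DecidableEq (F × (Fin n → F))] {S : Set (Fin n → F)}
    (hS : ∀ W : AffineSubspace F (Fin n → F), Module.finrank F W.direction = n - 1 →
      (S ∩ (W : Set (Fin n → F))).ncard ≤ n) {S' : Finset (F × (Fin n → F))}
    (hS' : (S' : Set (F × (Fin n → F))) = (fun x => ((1 : F), x)) '' S) (hcard : n < S'.card) :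
    AvoidsSpans F n S' S' := by
  intro Q hQ hQn p hp hpQ hspan
  obtain ⟨Q', hQQ', hQ'S, hQ'n⟩ := Finset.exists_subsuperset_card_eq
    (Finset.subset_erase.2 ⟨hQ, hpQ⟩) hQn (by rw [Finset.card_erase_of_mem hp]; omega)
  have hpQ' : p ∉ Q' := fun h => Finset.notMem_erase p S' (hQ'S h)
  have hlt : Submodule.span F (Q' : Set (F × (Fin n → F))) < ⊤ := by
    rw [lt_top_iff_ne_top]
    intro htop
    have h1 := finrank_span_finset_le_card (R := F) Q'
    rw [Set.finrank, htop, finrank_top, Module.finrank_prod, Module.finrank_self,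
      Module.finrank_fin_fun, hQ'n] at h1
    omega
  obtain ⟨f, hf0, hf⟩ := Submodule.exists_le_ker_of_lt_top _ hlt
  have hmem : ∀ z ∈ insert p Q', f z = 0 := by
    intro z hz
    refine LinearMap.mem_ker.1 (hf ?_)
    rcases Finset.mem_insert.1 hz with rfl | hz
    · exact Submodule.span_mono (Finset.coe_subset.2 hQQ') hspan
    · exact Submodule.subset_span hz
  have hsubS : ∀ z ∈ insert p Q', ∃ x ∈ S, ((1 : F), x) = z := by
    intro z hz
    have : z ∈ (S' : Set (F × (Fin n → F))) := by
      rcases Finset.mem_insert.1 hz with rfl | hz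
      · exact hp
      · exact Finset.mem_of_mem_erase (hQ'S hz)
    rwa [hS'] at this
  obtain ⟨x₀, -, hx₀⟩ := hsubS p (Finset.mem_insert_self _ _)
  have hfx₀ : f (1, x₀) = 0 := hx₀ ▸ hmem p (Finset.mem_insert_self _ _)
  let ψ : Module.Dual F (Fin n → F) := f ∘ₗ LinearMap.inr F F (Fin n → F)
  have hψ : ∀ x, f (1, x) = f (1, 0) + ψ x := fun x => by
    simp [ψ, ← map_add]
  have hψ0 : ψ ≠ 0 := by
    intro h
    have h1 : f (1, 0) = 0 := by rwa [hψ, h, LinearMap.zero_apply, add_zero] at hfx₀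
    refine hf0 (LinearMap.ext fun z => ?_)
    have h2 : z = z.1 • ((1 : F), (0 : Fin n → F)) + LinearMap.inr F F (Fin n → F) z.2 := by
      simp
    rw [h2, map_add, map_smul, h1]
    simpa [ψ] using LinearMap.congr_fun h z.2
  have hrank : Module.finrank F (AffineSubspace.mk' x₀ (LinearMap.ker ψ)).direction = n - 1 := by
    rw [AffineSubspace.direction_mk']
    have := Module.Dual.finrank_ker_add_one_of_ne_zero hψ0
    rw [Module.finrank_fin_fun] at this
    omega
  have hle := hS _ hrank
  have hincl : ((insert p Q' : Finset _) : Set (F × (Fin n → F))) ⊆ (fun x => ((1 : F), x)) ''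
      (S ∩ (AffineSubspace.mk' x₀ (LinearMap.ker ψ) : Set (Fin n → F))) := by
    intro z hz
    obtain ⟨x, hxS, rfl⟩ := hsubS z hz
    refine ⟨x, ⟨hxS, ?_⟩, rfl⟩
    have h1 := hmem _ hz
    rw [hψ] at h1 hfx₀
    rw [SetLike.mem_coe, AffineSubspace.mem_mk', vsub_eq_sub, LinearMap.mem_ker, map_sub,
      sub_eq_zero]
    exact add_left_cancel (h1.trans hfx₀.symm)
  have h1 := Set.ncard_le_ncard hincl (Set.toFinite _)
  rw [Set.ncard_coe_finset, Finset.card_insert_of_notMem hpQ', hQ'n] at h1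
  have h2 := Set.ncard_image_le (f := fun x => ((1 : F), x))
    (Set.toFinite (S ∩ (AffineSubspace.mk' x₀ (LinearMap.ker ψ) : Set (Fin n → F))))
  omega

/-- The container-type bound for the number of general position sets, before choosing parameters. -/
theorem ncard_general_position_le [Fintype F] {t m R : ℕ} (hn : 1 ≤ n) (ht : n < t) {β : ℝ}
    (hβ1 : β ≤ 1)
    (hβ : ∀ a : ℕ, R < a → β * a * (n * (Fintype.card F + 1)) ≤
      ((t : ℝ) - n) * (a - (Fintype.card F + 1)))
    (hm : (1 - β) ^ m * (Fintype.card F : ℝ) ^ n ≤ R) :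
    {S : Set (Fin n → F) | ∀ W : AffineSubspace F (Fin n → F),
      Module.finrank F W.direction = n - 1 → (S ∩ (W : Set (Fin n → F))).ncard ≤ n}.ncard ≤
      2 * (Fintype.card F ^ n + 1) ^ (t + m) * 2 ^ R := by
  classical
  let hat : (Fin n → F) → F × (Fin n → F) := fun x => (1, x)
  have hhat : Function.Injective hat := Prod.mk_right_injective 1
  let X : Finset (F × (Fin n → F)) := Finset.univ.image hat
  have hX : X.card = Fintype.card F ^ n := by
    rw [Finset.card_image_of_injective _ hhat]
    simp
  have hinj : ∀ x ∈ X, ∀ y ∈ X, y ∈ Submodule.span F {x} → y = x := by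
    intro x hx y hy hxy
    obtain ⟨x, -, rfl⟩ := Finset.mem_image.1 hx
    obtain ⟨y, -, rfl⟩ := Finset.mem_image.1 hy
    obtain ⟨c, hc⟩ := Submodule.mem_span_singleton.1 hxy
    have hc1 : c = 1 := by simpa [hat] using congrArg Prod.fst hc
    rw [← hc, hc1, one_smul]
  have hX2 : 2 ≤ X.card := by
    rw [hX]
    exact Fintype.one_lt_card.trans_le (Nat.le_self_pow (by omega) _)
  have hE : Module.finrank F (F × (Fin n → F)) = n + 1 := by
    rw [Module.finrank_prod, Module.finrank_self, Module.finrank_fin_fun, add_comm]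
  have hmain := card_avoidsSpans_le hn hE hinj hX2 ht hβ1 hβ (m := m)
    (by rw [hX]; exact_mod_cast hm)
  rw [hX] at hmain
  refine le_trans ?_ hmain
  rw [← Set.ncard_coe_finset]
  refine Set.ncard_le_ncard_of_injOn (fun S => S.toFinset.image hat) (fun S hS => ?_)
    (fun S _ S' _ h => ?_) (Finset.finite_toSet _)
  · refine Finset.mem_coe.2 (Finset.mem_filter.2 ⟨Finset.mem_powerset.2
      (Finset.image_subset_image (Finset.subset_univ _)), fun h => ?_⟩)
    exact avoidsSpans_homogenize hS (by simp [hat]) (by omega)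
  · exact Set.toFinset_inj.1 (Finset.image_injective hhat h)

end Homogenization

/-- The choice of parameters `t = ⌈q^(2/3)⌉` and `m = ⌈12 n² q^(2/3) log q⌉` is admissible. -/
theorem eventually_parameters (n : ℕ) (hn : 1 ≤ n) (ε : ℝ) (hε : 0 < ε) :
    ∃ q0 : ℕ, ∀ q : ℕ, q0 ≤ q → 2 ≤ q ∧ 2 * (n : ℝ) < (q : ℝ) ^ ((2 : ℝ) / 3) ∧
      2 + (⌈(q : ℝ) ^ ((2 : ℝ) / 3)⌉₊ : ℝ) + Real.logb 2 q * (2 * n *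
        (⌈(q : ℝ) ^ ((2 : ℝ) / 3)⌉₊ + ⌈12 * (n : ℝ) ^ 2 * (q : ℝ) ^ ((2 : ℝ) / 3) * Real.log q⌉₊))
        ≤ (q : ℝ) ^ ((2 : ℝ) / 3 + ε) := by
  have hn' : (1 : ℝ) ≤ n := by exact_mod_cast hn
  set C : ℝ := 4 + 60 * (n : ℝ) ^ 3 with hC
  have hCpos : 0 < C := by positivity
  have h1 := (isLittleO_log_rpow_rpow_atTop 2 hε).def (inv_pos.2 hCpos)
  have h2 := (tendsto_rpow_atTop (by norm_num : (0 : ℝ) < 2 / 3)).eventually_gt_atTop (2 * (n : ℝ))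
  have h3 := Real.tendsto_log_atTop.eventually_ge_atTop 1
  obtain ⟨q0, hq0⟩ := Filter.eventually_atTop.1 (tendsto_natCast_atTop_atTop.eventually
    (h1.and (h2.and (h3.and (Filter.eventually_ge_atTop (2 : ℝ))))))
  refine ⟨q0, fun q hq => ?_⟩
  obtain ⟨ho, hy, hL, hq2⟩ := hq0 q hq
  refine ⟨by exact_mod_cast hq2, hy, ?_⟩
  have hqpos : (0 : ℝ) < q := by linarith
  rw [Real.rpow_add hqpos]
  set y := (q : ℝ) ^ ((2 : ℝ) / 3)
  set L := Real.log q with hLdef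
  have hy1 : 1 ≤ y := by linarith
  have hCL : C * L ^ 2 ≤ (q : ℝ) ^ ε := by
    rw [Real.norm_of_nonneg (by positivity), Real.norm_of_nonneg (by positivity),
      inv_mul_eq_div, le_div_iff₀ hCpos, Real.rpow_two] at ho
    linarith
  have hk : (⌈y⌉₊ : ℝ) ≤ 2 * y := by
    have := (Nat.ceil_lt_add_one (by linarith : 0 ≤ y)).le
    linarith
  have hyL : 1 ≤ y * L := one_le_mul_of_one_le_of_one_le hy1 hL
  have hm : (⌈12 * (n : ℝ) ^ 2 * y * L⌉₊ : ℝ) ≤ 13 * (n : ℝ) ^ 2 * (y * L) := by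
    have h4 := (Nat.ceil_lt_add_one (by positivity : 0 ≤ 12 * (n : ℝ) ^ 2 * y * L)).le
    have h5 : 1 ≤ (n : ℝ) ^ 2 * (y * L) :=
      one_le_mul_of_one_le_of_one_le (one_le_pow₀ hn') hyL
    linarith
  have hlog : Real.logb 2 q ≤ 2 * L := by
    have := Real.log_two_gt_d9
    rw [Real.logb, div_le_iff₀ (by linarith)]
    nlinarith
  have hlog0 : 0 ≤ Real.logb 2 q := Real.logb_nonneg (by norm_num) (by linarith)
  have hyL2 : y ≤ y * L ^ 2 := le_mul_of_one_le_right (by linarith) (one_le_pow₀ hL)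
  have hyLL : y * L ≤ y * L ^ 2 := by
    rw [sq, ← mul_assoc]
    exact le_mul_of_one_le_right (by positivity) hL
  have hn3 : (n : ℝ) ≤ (n : ℝ) ^ 3 := le_self_pow₀ hn' (by norm_num)
  calc _ ≤ 2 * y + 2 * y + 2 * L * (2 * n * (2 * y + 13 * (n : ℝ) ^ 2 * (y * L))) := by
        gcongr
        linarith
    _ = 4 * y + 8 * n * (y * L) + 52 * (n : ℝ) ^ 3 * (y * L ^ 2) := by ring
    _ ≤ 4 * (y * L ^ 2) + 8 * (n : ℝ) ^ 3 * (y * L ^ 2) + 52 * (n : ℝ) ^ 3 * (y * L ^ 2) := by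
        gcongr
    _ = y * (C * L ^ 2) := by rw [hC]; ring
    _ ≤ _ := by gcongr

/-- For every integer `n ≥ 2` and every `ε > 0` there exists `q₀` such that
for every prime power `q ≥ q₀` (i.e. every finite field `F` of cardinality `q`), the number
of general position sets in `F^n` (sets meeting every affine hyperplane in at most `n`
points) is at most `2 ^ (q + q^(2/3+ε))`. -/
theorem statement12 (n : ℕ) (hn : 2 ≤ n) (ε : ℝ) (hε : 0 < ε) :
    ∃ q0 : ℕ, ∀ q : ℕ, q0 ≤ q → IsPrimePow q →
      ∀ (F : Type) [Field F] [Fintype F], Fintype.card F = q →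
        (({S : Set (Fin n → F) |
            ∀ W : AffineSubspace F (Fin n → F),
              Module.finrank F W.direction = n - 1 →
                (S ∩ (W : Set (Fin n → F))).ncard ≤ n}.ncard : ℝ)) ≤
          2 ^ ((q : ℝ) + (q : ℝ) ^ ((2 : ℝ) / 3 + ε)) := by
  obtain ⟨q0, hq0⟩ := eventually_parameters n (by omega) ε hε
  refine ⟨q0, fun q hq _ F _ _ hF => ?_⟩
  obtain ⟨hq2, hny, hexp⟩ := hq0 q hq
  set y := (q : ℝ) ^ ((2 : ℝ) / 3) with hy
  set t := ⌈y⌉₊ with ht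
  set m := ⌈12 * (n : ℝ) ^ 2 * y * Real.log q⌉₊ with hm
  have hn' : (2 : ℝ) ≤ n := by exact_mod_cast hn
  have hq2' : (2 : ℝ) ≤ q := by exact_mod_cast hq2
  have hqpos : (0 : ℝ) < q := by linarith
  have hypos : 0 < y := by linarith
  have hyt : y ≤ t := Nat.le_ceil y
  have hy3 : y ^ 3 = (q : ℝ) ^ 2 := by
    rw [hy, ← Real.rpow_natCast, ← Real.rpow_mul hqpos.le, ← Real.rpow_natCast]
    norm_num
  have hyq : y ≤ q := Real.rpow_le_self_of_one_le (by linarith) (by norm_num)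
  have hqy : (q : ℝ) ≤ y ^ 2 := by
    rw [hy, ← Real.rpow_natCast, ← Real.rpow_mul hqpos.le]
    exact Real.self_le_rpow_of_one_le (by linarith) (by norm_num)
  have hnt : n < t := by
    have : (n : ℝ) < t := by linarith
    exact_mod_cast this
  have hcount := ncard_general_position_le (F := F) (n := n) (t := t) (m := m) (R := q + 1 + t)
    (β := 1 / (12 * n * y)) (by omega) hnt
    (by
      rw [div_le_one (by positivity)]
      nlinarith)
    (by
      intro a ha
      rw [hF]
      have ha' : (q : ℝ) + 1 + t < a := by exact_mod_cast ha
      have h1 : (a : ℝ) * (q + 1) ≤ 6 * y ^ 2 * (a - (q + 1)) := by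
        have h2 : 0 ≤ (6 * y ^ 2 - (q + 1)) * (a - (q + 1 + y)) :=
          mul_nonneg (by linarith) (by linarith)
        have h3 : (q + 1 + y) * ((q : ℝ) + 1) ≤ 6 * y ^ 3 := by
          rw [hy3]
          nlinarith
        linarith
      calc _ = (a : ℝ) * (q + 1) / (12 * y) := by field_simp
        _ ≤ 6 * y ^ 2 * (a - (q + 1)) / (12 * y) := by gcongr
        _ = y / 2 * (a - (q + 1)) := by field_simp; ring
        _ ≤ _ := by
          gcongr <;> linarith)
    (by
      rw [hF]
      have h1 : (1 - 1 / (12 * n * y)) ^ m ≤ Real.exp (-(n * Real.log q)) := by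
        calc _ ≤ Real.exp (-(1 / (12 * n * y))) ^ m := by
              gcongr
              · rw [sub_nonneg, div_le_one (by positivity)]
                nlinarith
              · exact Real.one_sub_le_exp_neg _
          _ = Real.exp (-(m * (1 / (12 * n * y)))) := by
              rw [← Real.exp_nat_mul]
              ring_nf
          _ ≤ _ := by
              refine Real.exp_le_exp.2 (neg_le_neg ?_)
              rw [mul_one_div, le_div_iff₀ (by positivity)]
              refine le_trans (le_of_eq ?_) (Nat.le_ceil _)
              ring
      have h2 : Real.exp (-(n * Real.log q)) * (q : ℝ) ^ n = 1 := by
        rw [Real.exp_neg, Real.exp_nat_mul, Real.exp_log hqpos, inv_mul_cancel₀ (by positivity)]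
      calc _ ≤ Real.exp (-(n * Real.log q)) * (q : ℝ) ^ n := by gcongr
        _ = 1 := h2
        _ ≤ _ := by
          push_cast
          linarith)
  rw [hF] at hcount
  have hN : q ^ n + 1 ≤ q ^ (2 * n) := by
    have h1 : 2 ≤ q ^ n := hq2.trans (Nat.le_self_pow (by omega) _)
    rw [two_mul, pow_add]
    nlinarith
  have hcount' := hcount.trans (Nat.mul_le_mul_right _ (Nat.mul_le_mul_left _
    (Nat.pow_le_pow_left hN (t + m))))
  have hqlog : (q : ℝ) = 2 ^ Real.logb 2 q :=
    (Real.rpow_logb (by norm_num) (by norm_num) hqpos).symm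
  calc _ ≤ ((2 * (q ^ (2 * n)) ^ (t + m) * 2 ^ (q + 1 + t) : ℕ) : ℝ) := by exact_mod_cast hcount'
    _ = (2 : ℝ) ^ (1 + Real.logb 2 q * (2 * n * (t + m)) + ((q : ℝ) + 1 + t)) := by
      rw [Real.rpow_add two_pos, Real.rpow_add two_pos, Real.rpow_mul two_pos.le, ← hqlog,
        Real.rpow_one]
      push_cast
      rw [← pow_mul, ← Real.rpow_natCast, ← Real.rpow_natCast]
      push_cast
      rfl
    _ ≤ _ := by
      refine Real.rpow_le_rpow_of_exponent_le one_le_two ?_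
      linarith
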